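/- arXiv:1206.3214 — 2 statements merged into one kernel-verified Lean document; each statement's English description precedes it below -/
import Mathlib

section
/- Let (X,T) be a topological dynamical system on a compact metric space, r ≥ 1 an integer, Φ : X^r → ℝ continuous, and α ∈ ℝ. If E_Φ(α) ≠ ∅, then there exists a T-invariant Borel probability measure μ with ∫_{X^r} Φ dμ^{⊗r} = α; equivalently, if M_Φ(α) = ∅ then E_Φ(α) = ∅. -/
open MeasureTheory Filter Topology
open scoped ENNReal NNReal

section Defs

variable {X : Type*} [MetricSpace X]

/-- The Bowen ball `B_n(x, ε)` for the dynamics `T`. -/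
def bowenBall (T : X → X) (n : ℕ) (ε : ℝ) (x : X) : Set X :=
  {y | ∀ j < n, dist (T^[j] x) (T^[j] y) < ε}

/-- `H^s_n(Z, ε)`: infimum of `∑ exp(-s n_i)` over countable covers of `Z` by Bowen balls
`B_{n_i}(x_i, ε)` with `n_i ≥ n`. -/
noncomputable def bowenHn (T : X → X) (Z : Set X) (s ε : ℝ) (n : ℕ) : ℝ≥0∞ :=
  ⨅ (c : ℕ → X × ℕ) (_ : Z ⊆ ⋃ i, bowenBall T (c i).2 ε (c i).1) (_ : ∀ i, n ≤ (c i).2),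
    ∑' i, ENNReal.ofReal (Real.exp (-(s * ((c i).2 : ℝ))))

/-- `H^s(Z, ε) = lim_n H^s_n(Z, ε)` (the quantities are nondecreasing in `n`). -/
noncomputable def bowenH (T : X → X) (Z : Set X) (s ε : ℝ) : ℝ≥0∞ :=
  ⨆ n : ℕ, bowenHn T Z s ε n

/-- `h_top(Z, ε)`: the critical value of `s ↦ H^s(Z, ε)`. -/
noncomputable def bowenEnt (T : X → X) (Z : Set X) (ε : ℝ) : ℝ≥0∞ :=
  ⨅ (s : ℝ≥0) (_ : bowenH T Z s ε = 0), (s : ℝ≥0∞)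

/-- Bowen's topological entropy of an arbitrary subset `Z ⊆ X`:
`h_top(Z) = lim_{ε → 0} h_top(Z, ε)`. -/
noncomputable def htop (T : X → X) (Z : Set X) : ℝ≥0∞ :=
  ⨆ (ε : ℝ) (_ : 0 < ε), bowenEnt T Z ε

variable [MeasurableSpace X]

/-- Shannon entropy of the finite measurable partition of `X` induced by `P : X → ι`. -/
noncomputable def partEntropy {ι : Type} [Fintype ι] (μ : Measure X) (P : X → ι) : ℝ :=
  ∑ i : ι, Real.negMulLog ((μ (P ⁻¹' {i})).toReal)

/-- The measure-theoretic (Kolmogorov–Sinai) entropy `h_μ(T)`: supremum over finite measurable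
partitions `P` of `lim_n (1/n) H_μ(P ∨ T⁻¹P ∨ ⋯ ∨ T^{-(n-1)}P)`, the limit being the
infimum by subadditivity. -/
noncomputable def hKS (T : X → X) (μ : Measure X) : ℝ≥0∞ :=
  ⨆ (k : ℕ) (P : X → Fin k) (_ : Measurable P),
    ENNReal.ofReal (⨅ n : ℕ,
      partEntropy μ (fun x => fun j : Fin (n + 1) => P (T^[(j : ℕ)] x)) / (n + 1))

/-- The V-statistics `V_Φ(n, x) = n^{-r} ∑_{1 ≤ i_1, …, i_r ≤ n} Φ(T^{i_1}x, …, T^{i_r}x)`. -/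
noncomputable def Vstat {r : ℕ} (T : X → X) (Φ : (Fin r → X) → ℝ) (n : ℕ) (x : X) : ℝ :=
  (∑ i : Fin r → Fin n, Φ (fun j => T^[(i j : ℕ) + 1] x)) / (n : ℝ) ^ r

/-- The level set `E_Φ(α) = {x : lim_n V_Φ(n,x) = α}`. -/
def Eset {r : ℕ} (T : X → X) (Φ : (Fin r → X) → ℝ) (α : ℝ) : Set X :=
  {x | Tendsto (fun n => Vstat T Φ n x) atTop (𝓝 α)}

/-- The fiber `M_Φ(α)`: the `T`-invariant Borel probability measures `μ` with
`∫_{X^r} Φ dμ^{⊗r} = α`. -/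
def Mset {r : ℕ} (T : X → X) (Φ : (Fin r → X) → ℝ) (α : ℝ) : Set (Measure X) :=
  {μ | IsProbabilityMeasure μ ∧ MeasurePreserving T μ μ ∧
    ∫ y, Φ y ∂(Measure.pi fun _ : Fin r => μ) = α}

end Defs

/-- The uniform probability measure on `Fin (n+1)`. -/
noncomputable def unifFin (n : ℕ) : ProbabilityMeasure (Fin (n + 1)) :=
  ⟨(PMF.uniformOfFintype (Fin (n + 1))).toMeasure, inferInstance⟩

lemma unifFin_singleton (n : ℕ) (i : Fin (n + 1)) :
    ((unifFin n : ProbabilityMeasure (Fin (n + 1))) : Measure (Fin (n + 1))) {i}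
      = ((n : ℝ≥0∞) + 1)⁻¹ := by
  change (PMF.uniformOfFintype (Fin (n + 1))).toMeasure {i} = _
  rw [PMF.toMeasure_apply_singleton _ _ (measurableSet_singleton i)]
  simp

/-- The empirical measure of `T x, …, T^{n+1} x`. -/
noncomputable def empMeas {X : Type*} [MeasurableSpace X] (T : X → X) (x : X) (n : ℕ) :
    ProbabilityMeasure X :=
  (unifFin n).map (f := fun i : Fin (n + 1) => T^[(i : ℕ) + 1] x)
    (measurable_of_finite _).aemeasurable

lemma empMeas_toMeasure {X : Type*} [MeasurableSpace X] (T : X → X) (x : X) (n : ℕ) :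
    (empMeas T x n : Measure X) =
      Measure.map (fun i : Fin (n + 1) => T^[(i : ℕ) + 1] x) (unifFin n : Measure (Fin (n + 1))) :=
  rfl

lemma integral_empMeas {X : Type*} [MetricSpace X] [CompactSpace X] [MeasurableSpace X]
    [BorelSpace X] (T : X → X) (x : X) (n : ℕ) (f : X → ℝ) (hf : Continuous f) :
    ∫ y, f y ∂(empMeas T x n : Measure X)
      = (∑ i ∈ Finset.range (n + 1), f (T^[i + 1] x)) / ((n : ℝ) + 1) := by
  rw [empMeas_toMeasure, integral_map (measurable_of_finite _).aemeasurable
    hf.measurable.aestronglyMeasurable, integral_fintype (Integrable.of_finite),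
    ← Fin.sum_univ_eq_sum_range (fun i => f (T^[i + 1] x)), Finset.sum_div]
  refine Finset.sum_congr rfl fun i _ => ?_
  rw [measureReal_def, unifFin_singleton, ENNReal.toReal_inv,
    ENNReal.toReal_add (by simp) (by simp)]
  simp [div_eq_inv_mul]

lemma integral_pi_empMeas {X : Type*} [MetricSpace X] [CompactSpace X] [MeasurableSpace X]
    [BorelSpace X] (T : X → X) (x : X) (n r : ℕ) (Φ : (Fin r → X) → ℝ) (hΦ : Continuous Φ) :
    ∫ y, Φ y ∂(Measure.pi fun _ : Fin r => (empMeas T x n : Measure X))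
      = Vstat T Φ (n + 1) x := by
  have h := Measure.pi_map_pi (ι := Fin r)
    (μ := fun _ => (unifFin n : Measure (Fin (n + 1))))
    (f := fun _ (i : Fin (n + 1)) => T^[(i : ℕ) + 1] x)
    (fun _ => (measurable_of_finite _).aemeasurable)
  simp only [empMeas_toMeasure]
  rw [← h, integral_map (measurable_of_finite _).aemeasurable
    hΦ.measurable.aestronglyMeasurable, integral_fintype (Integrable.of_finite), Vstat,
    Finset.sum_div]
  refine Finset.sum_congr rfl fun i _ => ?_
  rw [measureReal_def, Measure.pi_singleton]
  simp only [unifFin_singleton]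
  rw [Finset.prod_const, ENNReal.toReal_pow, ENNReal.toReal_inv,
    ENNReal.toReal_add (by simp) (by simp)]
  simp [div_eq_inv_mul]

/-- If `E_Φ(α)` is nonempty, then the fiber `M_Φ(α)` is nonempty, i.e. there is
a `T`-invariant Borel probability measure `μ` with `∫_{X^r} Φ dμ^{⊗r} = α`. -/
theorem exists_invariant_measure_of_Eset_nonempty
    {X : Type*} [MetricSpace X] [CompactSpace X] [MeasurableSpace X] [BorelSpace X]
    (T : X → X) (hT : Continuous T) (r : ℕ) (hr : 1 ≤ r)
    (Φ : (Fin r → X) → ℝ) (hΦ : Continuous Φ) (α : ℝ)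
    (hE : (Eset T Φ α).Nonempty) :
    ∃ μ : Measure X, IsProbabilityMeasure μ ∧ MeasurePreserving T μ μ ∧
      ∫ y, Φ y ∂(Measure.pi fun _ : Fin r => μ) = α := by
  obtain ⟨x, hx⟩ := hE
  have hx' : Tendsto (fun n => Vstat T Φ n x) atTop (𝓝 α) := hx
  let U : Ultrafilter ℕ := hyperfilter ℕ
  have hU : (U : Filter ℕ) ≤ atTop := Nat.hyperfilter_le_atTop
  obtain ⟨μ, -, hμ⟩ := (isCompact_univ (X := ProbabilityMeasure X)).ultrafilter_le_nhds
    (U.map (empMeas T x)) (by simp)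
  have hlim : Tendsto (empMeas T x) U (𝓝 μ) := hμ
  refine ⟨μ, inferInstance, ⟨hT.measurable, ?_⟩, ?_⟩
  · have : IsProbabilityMeasure (Measure.map T (μ : Measure X)) :=
      Measure.isProbabilityMeasure_map hT.measurable.aemeasurable
    refine ext_of_forall_integral_eq_of_IsFiniteMeasure fun f => ?_
    rw [integral_map hT.measurable.aemeasurable f.continuous.measurable.aestronglyMeasurable]
    have hl := ProbabilityMeasure.tendsto_iff_forall_integral_tendsto.1 hlim
    have h1 := hl f
    have h2 := hl (f.compContinuous ⟨T, hT⟩)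
    have h3 := h2.sub h1
    have h4 : Tendsto (fun n => ∫ y, (f.compContinuous ⟨T, hT⟩) y ∂(empMeas T x n : Measure X)
        - ∫ y, f y ∂(empMeas T x n : Measure X)) atTop (𝓝 0) := by
      have h5 : Tendsto (fun n : ℕ => (2 * ‖f‖) / ((n : ℝ) + 1)) atTop (𝓝 0) :=
        tendsto_const_nhds.div_atTop
          (tendsto_natCast_atTop_atTop.atTop_add tendsto_const_nhds)
      refine squeeze_zero_norm (fun n => ?_) h5
      rw [integral_empMeas _ _ _ _ (BoundedContinuousFunction.continuous _),
        integral_empMeas _ _ _ _ f.continuous, ← sub_div, ← Finset.sum_sub_distrib]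
      have h6 : ∀ i, (f.compContinuous ⟨T, hT⟩) (T^[i + 1] x) = f (T^[i + 1 + 1] x) := by
        intro i
        rw [Function.iterate_succ_apply' T (i + 1)]
        rfl
      simp only [h6]
      rw [Finset.sum_range_sub (fun i => f (T^[i + 1] x)), norm_div,
        Real.norm_of_nonneg (by positivity : (0 : ℝ) ≤ (n : ℝ) + 1)]
      gcongr
      calc _ ≤ ‖f (T^[n + 1 + 1] x)‖ + ‖f (T^[0 + 1] x)‖ := norm_sub_le _ _
        _ ≤ 2 * ‖f‖ := by
          linarith [f.norm_coe_le_norm (T^[n + 1 + 1] x), f.norm_coe_le_norm (T^[0 + 1] x)]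
    have h7 := tendsto_nhds_unique h3 (h4.mono_left hU)
    exact sub_eq_zero.1 h7
  · have hpi : Tendsto (fun n => ProbabilityMeasure.pi (fun _ : Fin r => empMeas T x n)) U
        (𝓝 (ProbabilityMeasure.pi (fun _ : Fin r => μ))) :=
      (ProbabilityMeasure.continuous_pi.tendsto _).comp (tendsto_pi_nhds.2 fun _ => hlim)
    have h1 := ProbabilityMeasure.tendsto_iff_forall_integral_tendsto.1 hpi
      (BoundedContinuousFunction.mkOfCompact ⟨Φ, hΦ⟩)
    simp only [BoundedContinuousFunction.mkOfCompact_apply, ContinuousMap.coe_mk,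
      ProbabilityMeasure.toMeasure_pi, integral_pi_empMeas T x _ r Φ hΦ] at h1
    exact tendsto_nhds_unique h1 ((hx'.comp (tendsto_add_atTop_nat 1)).mono_left hU)
end

section
/- Let (X,T) be a saturated topological dynamical system on a compact metric space, r ≥ 1 an integer, Φ : X^r → ℝ continuous, and α ∈ ℝ with M_Φ(α) ≠ ∅. Then h_top(E_Φ(α)) = sup_{μ ∈ M_Φ(α)} h_μ. -/
open MeasureTheory Filter Topology
open scoped ENNReal NNReal

section Defs

variable {X : Type*} [MetricSpace X]

variable [MeasurableSpace X]

/-- `x` is a generic point of `μ`: the empirical measures `(1/n) ∑_{j<n} δ_{T^j x}`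
converge to `μ` in the weak star topology. -/
def IsGenericPt {X : Type*} [MetricSpace X] [MeasurableSpace X] (T : X → X) (μ : Measure X)
    (x : X) : Prop :=
  ∀ f : C(X, ℝ),
    Tendsto (fun n : ℕ => (∑ j ∈ Finset.range n, f (T^[j] x)) / n) atTop (𝓝 (∫ y, f y ∂μ))

/-- A system is saturated if `h_top(G_μ) = h_μ` for every `T`-invariant Borel probability
measure `μ`, where `G_μ` is the set of `μ`-generic points. -/
def Saturated {X : Type*} [MetricSpace X] [MeasurableSpace X] (T : X → X) : Prop :=
  ∀ μ : Measure X, IsProbabilityMeasure μ → MeasurePreserving T μ μ →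
    htop T {x | IsGenericPt T μ x} = hKS T μ

end Defs


section PartA

variable {X : Type*} [MetricSpace X]

lemma bowenHn_mono_set (T : X → X) {Z Z' : Set X} (h : Z ⊆ Z') (s ε : ℝ) (n : ℕ) :
    bowenHn T Z s ε n ≤ bowenHn T Z' s ε n := by
  unfold bowenHn
  refine le_iInf fun c => le_iInf fun hc => le_iInf fun hn => ?_
  exact iInf_le_of_le c (iInf_le_of_le (h.trans hc) (iInf_le_of_le hn le_rfl))

lemma htop_mono (T : X → X) {Z Z' : Set X} (h : Z ⊆ Z') : htop T Z ≤ htop T Z' := by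
  unfold htop
  refine iSup_mono fun ε => iSup_mono fun hε => ?_
  unfold bowenEnt
  refine le_iInf fun s => le_iInf fun hs => ?_
  refine iInf_le_of_le s (iInf_le_of_le ?_ le_rfl)
  refine le_antisymm ?_ bot_le
  rw [← hs]
  exact iSup_mono fun n => bowenHn_mono_set T h _ _ _

lemma exists_small_tail {s : ℝ} (hs : 0 < s) (N : ℕ) {η : ℝ≥0∞} (hη : η ≠ 0) :
    ∃ M, N ≤ M ∧ ∑' i : ℕ, ENNReal.ofReal (Real.exp (-(s * ((i + M : ℕ) : ℝ)))) ≤ η := by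
  have hsum : Summable fun i : ℕ => Real.exp (-(s * (i : ℝ))) := by
    have := Real.summable_exp_nat_mul_iff.2 (show -s < 0 by linarith)
    refine this.congr fun i => ?_
    congr 1; ring
  have hne : ∑' i : ℕ, ENNReal.ofReal (Real.exp (-(s * (i : ℝ)))) ≠ ⊤ := by
    rw [← ENNReal.ofReal_tsum_of_nonneg (fun _ => (Real.exp_pos _).le) hsum]
    exact ENNReal.ofReal_ne_top
  have ht := ENNReal.tendsto_sum_nat_add (fun i : ℕ => ENNReal.ofReal (Real.exp (-(s * (i : ℝ))))) hne
  have hev := (ht.eventually (ge_mem_nhds (pos_iff_ne_zero.2 hη))).and (eventually_ge_atTop N)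
  obtain ⟨M, h1, h2⟩ := hev.exists
  exact ⟨M, h2, h1⟩

lemma bowenHn_le_tsum [Nonempty X] (T : X → X) (Z : Set X) {s : ℝ} (hs : 0 < s) (ε : ℝ) (N : ℕ)
    {ι : Type*} [Countable ι] (c : ι → X × ℕ) (hc : Z ⊆ ⋃ i, bowenBall T (c i).2 ε (c i).1)
    (hn : ∀ i, N ≤ (c i).2) :
    bowenHn T Z s ε N ≤ ∑' i, ENNReal.ofReal (Real.exp (-(s * ((c i).2 : ℝ)))) := by
  refine _root_.le_of_forall_pos_le_add fun η hη => ?_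
  obtain ⟨M, hNM, hM⟩ := exists_small_tail hs N hη.ne'
  obtain ⟨e⟩ : Nonempty (ℕ ≃ ι ⊕ ℕ) := nonempty_equiv_of_countable
  let d : ι ⊕ ℕ → X × ℕ := Sum.elim c (fun i => (Classical.arbitrary X, i + M))
  have h1 : bowenHn T Z s ε N ≤ ∑' i, ENNReal.ofReal (Real.exp (-(s * ((d (e i)).2 : ℝ)))) := by
    refine iInf_le_of_le (fun i => d (e i)) (iInf_le_of_le ?_ (iInf_le_of_le ?_ le_rfl))
    · intro x hx
      obtain ⟨i, hi⟩ := Set.mem_iUnion.1 (hc hx)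
      refine Set.mem_iUnion.2 ⟨e.symm (Sum.inl i), ?_⟩
      simpa [d] using hi
    · intro i
      rcases h : e i with j | j
      · simpa [h, d] using hn j
      · simp only [h, d, Sum.elim_inr]; omega
  refine h1.trans ?_
  rw [e.tsum_eq (fun z => ENNReal.ofReal (Real.exp (-(s * ((d z).2 : ℝ))))),
    Summable.tsum_sum ENNReal.summable ENNReal.summable]
  exact add_le_add le_rfl hM

lemma bowenHn_union_zero [Nonempty X] (T : X → X) {Z Z' : Set X} {s : ℝ} (hs : 0 < s) (ε : ℝ) (N : ℕ)
    (h : bowenHn T Z s ε N = 0) (h' : bowenHn T Z' s ε N = 0) :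
    bowenHn T (Z ∪ Z') s ε N = 0 := by
  refine le_antisymm (_root_.le_of_forall_pos_le_add fun η hη => ?_) bot_le
  have key : ∀ Z : Set X, bowenHn T Z s ε N = 0 → ∃ c : ℕ → X × ℕ,
      (Z ⊆ ⋃ i, bowenBall T (c i).2 ε (c i).1) ∧ (∀ i, N ≤ (c i).2) ∧
      ∑' i, ENNReal.ofReal (Real.exp (-(s * ((c i).2 : ℝ)))) < η / 2 := by
    intro Z hZ
    have : bowenHn T Z s ε N < η / 2 := by
      rw [hZ]; exact ENNReal.half_pos hη.ne'
    simp only [bowenHn, iInf_lt_iff] at this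
    obtain ⟨c, h1, h2, h3⟩ := this
    exact ⟨c, h1, h2, h3⟩
  obtain ⟨c, a1, a2, a3⟩ := key Z h
  obtain ⟨c', b1, b2, b3⟩ := key Z' h'
  refine (bowenHn_le_tsum T _ hs ε N (Sum.elim c c') ?_ ?_).trans ?_
  · rintro x (hx | hx)
    · obtain ⟨i, hi⟩ := Set.mem_iUnion.1 (a1 hx)
      exact Set.mem_iUnion.2 ⟨Sum.inl i, hi⟩
    · obtain ⟨i, hi⟩ := Set.mem_iUnion.1 (b1 hx)
      exact Set.mem_iUnion.2 ⟨Sum.inr i, hi⟩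
  · rintro (i | i)
    · exact a2 i
    · exact b2 i
  · rw [Summable.tsum_sum ENNReal.summable ENNReal.summable, zero_add]
    calc _ ≤ η / 2 + η / 2 := add_le_add a3.le b3.le
      _ = η := ENNReal.add_halves η

end PartA

section PartB

lemma sum_range_mul_blocks (f : ℕ → ℝ) (m L : ℕ) :
    ∑ i ∈ Finset.range (L * m), f i
      = ∑ j ∈ Finset.range m, ∑ l ∈ Finset.range L, f (j + l * m) := by
  induction L with
  | zero => simp
  | succ L ih =>
    rw [Nat.succ_mul, Finset.sum_range_add, ih]
    simp only [Finset.sum_range_succ, Finset.sum_add_distrib]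
    simp [add_comm]

open Classical in
lemma card_words {X : Type*} [Nonempty X] (T : X → X) {k m : ℕ} (hm : 0 < m) (P : X → Fin k)
    (q : (Fin m → Fin k) → ℝ) (hq : ∀ w, 0 < q w) (hq1 : ∑ w, q w = 1) (c : ℝ) (n : ℕ) :
    ∃ S : Finset (Fin n → Fin k),
      (S.card : ℝ) ≤ (m * k ^ (m + 1) * k ^ (2 * m) : ℕ) * Real.exp (n * c) ∧
      ∀ x, (∑ i ∈ Finset.range n, -Real.log (q fun a => P (T^[a] (T^[i + 1] x)))) ≤ n * (m * c) →
        (fun i : Fin n => P (T^[i] x)) ∈ S := by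
  set L := n / m - 1 with hL
  have hLn : L * m ≤ n := by
    calc L * m ≤ (n / m) * m := Nat.mul_le_mul_right _ (Nat.sub_le _ _)
      _ ≤ n := Nat.div_mul_le_self n m
  have hLn2 : n ≤ L * m + 2 * m := by
    have h1 : n < (n / m + 1) * m := by
      have := Nat.div_add_mod n m
      have := Nat.mod_lt n hm
      nlinarith
    have h2 : n / m + 1 ≤ L + 2 := by omega
    nlinarith [Nat.mul_le_mul_right m h2]
  have hqle : ∀ w, q w ≤ 1 := fun w => by
    rw [← hq1]; exact Finset.single_le_sum (fun i _ => (hq i).le) (Finset.mem_univ w)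
  have hg : ∀ w, 0 ≤ -Real.log (q w) := fun w => by
    have := Real.log_nonpos (hq w).le (hqle w); linarith
  let W : Set X := {x | (∑ i ∈ Finset.range n, -Real.log (q fun a => P (T^[a] (T^[i + 1] x))))
    ≤ n * (m * c)}
  have hj : ∀ x ∈ W, ∃ j : Fin m, ∑ l : Fin L,
      -Real.log (q fun a => P (T^[a] (T^[(j + l * m) + 1] x))) ≤ n * c := by
    intro x hx
    by_contra hcon
    push Not at hcon
    have h1 : ∑ i ∈ Finset.range (L * m), -Real.log (q fun a => P (T^[a] (T^[i + 1] x)))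
        ≤ n * (m * c) := by
      refine le_trans ?_ hx
      exact Finset.sum_le_sum_of_subset_of_nonneg (Finset.range_subset_range.2 hLn) (fun i _ _ => hg _)
    rw [sum_range_mul_blocks (fun i => -Real.log (q fun a => P (T^[a] (T^[i + 1] x))))] at h1
    have h2 : ∑ j ∈ Finset.range m, ((n : ℝ) * c) < ∑ j ∈ Finset.range m, ∑ l ∈ Finset.range L,
        -Real.log (q fun a => P (T^[a] (T^[(j + l * m) + 1] x))) := by
      apply Finset.sum_lt_sum_of_nonempty
      · simpa using hm.ne'
      · intro j hj
        have := hcon ⟨j, Finset.mem_range.1 hj⟩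
        rw [Finset.sum_range]
        exact this
    simp only [Finset.sum_const, Finset.card_range, nsmul_eq_mul] at h2
    nlinarith
  have : Nonempty (Fin m) := ⟨⟨0, hm⟩⟩
  choose! j hjs using hj
  let B : Finset (Fin L → Fin m → Fin k) :=
    Finset.univ.filter fun b => Real.exp (-(n * c)) ≤ ∏ l, q (b l)
  have hB : (B.card : ℝ) ≤ Real.exp (n * c) := by
    have h1 : (B.card : ℝ) * Real.exp (-(n * c)) ≤ 1 := by
      calc (B.card : ℝ) * Real.exp (-(n * c)) = ∑ b ∈ B, Real.exp (-(n * c)) := by simp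
        _ ≤ ∑ b ∈ B, ∏ l, q (b l) := Finset.sum_le_sum fun b hb => (Finset.mem_filter.1 hb).2
        _ ≤ ∑ b : Fin L → Fin m → Fin k, ∏ l, q (b l) :=
          Finset.sum_le_sum_of_subset_of_nonneg (Finset.subset_univ _)
            fun b _ _ => Finset.prod_nonneg fun l _ => (hq _).le
        _ = (∑ w, q w) ^ L := (Fintype.sum_pow _ _).symm
        _ = 1 := by rw [hq1, one_pow]
    rw [Real.exp_neg, ← div_eq_mul_inv, div_le_one (Real.exp_pos _)] at h1
    exact h1
  let S : Finset (Fin n → Fin k) :=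
    Finset.univ.filter fun w => ∃ x ∈ W, (fun i : Fin n => P (T^[i] x)) = w
  have hS : ∀ w : Fin n → Fin k, w ∈ S → ∃ x ∈ W, (fun i : Fin n => P (T^[i] x)) = w :=
    fun w hw => (Finset.mem_filter.1 hw).2
  choose! pt hptW hpt using hS
  let code : X → Fin m × (Fin L → Fin m → Fin k) × (Fin (m + 1) → Fin k) × (Fin (2 * m) → Fin k) :=
    fun x => (j x, fun l a => P (T^[a] (T^[(j x + l * m) + 1] x)), fun a => P (T^[a] x),
      fun a => P (T^[(n - 2 * m) + a] x))
  have hcode : ∀ x y, code x = code y → ∀ i < n, P (T^[i] x) = P (T^[i] y) := by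
    intro x y hxy i hi
    simp only [code, Prod.mk.injEq] at hxy
    obtain ⟨h1, h2, h3, h4⟩ := hxy
    by_cases c1 : i < m + 1
    · exact congrFun h3 ⟨i, c1⟩
    by_cases c2 : n - 2 * m ≤ i
    · have := congrFun h4 ⟨i - (n - 2 * m), by omega⟩
      simp only at this
      rwa [Nat.add_sub_cancel' c2] at this
    · have hjlt := (j x).2
      have hlt : (i - 1 - j x) / m < L := by
        rw [Nat.div_lt_iff_lt_mul hm]; omega
      have := congrFun (congrFun h2 ⟨(i - 1 - j x) / m, hlt⟩) ⟨(i - 1 - j x) % m, Nat.mod_lt _ hm⟩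
      simp only [← Function.iterate_add_apply, ← h1] at this
      have e : (i - 1 - j x) % m + ((j x : ℕ) + (i - 1 - j x) / m * m + 1) = i := by
        have := Nat.mod_add_div' (i - 1 - j x) m
        omega
      rwa [e] at this
  refine ⟨S, ?_, fun x hx => Finset.mem_filter.2 ⟨Finset.mem_univ _, x, hx, rfl⟩⟩
  have hcard : S.card ≤ ((Finset.univ : Finset (Fin m)) ×ˢ B ×ˢ
      (Finset.univ : Finset ((Fin (m + 1) → Fin k) × (Fin (2 * m) → Fin k)))).card := by
    apply Finset.card_le_card_of_injOn (fun w => code (pt w))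
    · intro w hw
      have hw' := hptW w hw
      simp only [Finset.coe_product, Set.mem_prod, Finset.coe_univ, Set.mem_univ, true_and, and_true, code]
      refine Finset.mem_coe.2 (Finset.mem_filter.2 ⟨Finset.mem_univ _, ?_⟩)
      have h1 := hjs _ hw'
      rw [Finset.sum_neg_distrib, ← Real.log_prod (fun l _ => (hq _).ne')] at h1
      rw [← Real.le_log_iff_exp_le (Finset.prod_pos fun l _ => hq _)]
      linarith
    · intro w hw w' hw' h
      rw [← hpt w hw, ← hpt w' hw']
      funext i
      exact hcode _ _ h i i.2
  have hcard' : (S.card : ℝ) ≤ (m * (B.card * (k ^ (m + 1) * k ^ (2 * m))) : ℕ) := by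
    refine (Nat.cast_le.2 hcard).trans (le_of_eq ?_)
    simp [Finset.card_product]
  refine hcard'.trans ?_
  push_cast
  calc (m : ℝ) * (B.card * (k ^ (m + 1) * k ^ (2 * m)))
      = (m * k ^ (m + 1) * k ^ (2 * m)) * B.card := by ring
    _ ≤ _ := by gcongr

lemma bowenHn_zero_of_words {X : Type*} [MetricSpace X] [Nonempty X] (T : X → X) {k m : ℕ} (hm : 0 < m)
    (P : X → Fin k) {ε : ℝ} (hP : ∀ x y, P x = P y → dist x y < ε)
    (q : (Fin m → Fin k) → ℝ) (hq : ∀ w, 0 < q w) (hq1 : ∑ w, q w = 1) {c s : ℝ} (hcs : c < s)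
    (hs : 0 < s) (N : ℕ) :
    bowenHn T {x | ∃ᶠ n : ℕ in atTop, (∑ i ∈ Finset.range n,
      -Real.log (q fun a => P (T^[a] (T^[i + 1] x)))) ≤ n * (m * c)} s ε N = 0 := by
  choose S hS1 hS2 using card_words T hm P q hq hq1 c
  set K : ℕ := m * k ^ (m + 1) * k ^ (2 * m) with hK
  have key : ∀ M, N ≤ M → bowenHn T {x | ∃ᶠ n : ℕ in atTop, (∑ i ∈ Finset.range n,
      -Real.log (q fun a => P (T^[a] (T^[i + 1] x)))) ≤ n * (m * c)} s ε N ≤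
      (K : ℝ≥0∞) * ∑' i : ℕ, ENNReal.ofReal (Real.exp (-((s - c) * ((i + M : ℕ) : ℝ)))) := by
    intro M hM
    classical
    let pt : (n : ℕ) → (Fin n → Fin k) → X := fun n w =>
      if h : ∃ x, (fun i : Fin n => P (T^[i] x)) = w then h.choose else Classical.arbitrary X
    have hpt : ∀ n x, (fun i : Fin n => P (T^[i] (pt n (fun i : Fin n => P (T^[i] x)))))
        = (fun i : Fin n => P (T^[i] x)) := by
      intro n x
      have h : ∃ y, (fun i : Fin n => P (T^[i] y)) = (fun i : Fin n => P (T^[i] x)) := ⟨x, rfl⟩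
      simp only [pt, dif_pos h]
      exact h.choose_spec
    refine (bowenHn_le_tsum T _ hs ε N (ι := Σ n : ℕ, {w // w ∈ S (n + M)})
      (fun p => (pt (p.1 + M) p.2.1, p.1 + M)) ?_ ?_).trans ?_
    · intro x hx
      obtain ⟨n, hn1, hn2⟩ := (frequently_atTop.1 hx) M
      obtain ⟨n, rfl⟩ := Nat.exists_eq_add_of_le' hn1
      refine Set.mem_iUnion.2 ⟨⟨n, ⟨_, hS2 _ x hn2⟩⟩, ?_⟩
      intro i hi
      exact hP _ _ (congrFun (hpt (n + M) x) ⟨i, hi⟩)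
    · intro p; simp only; omega
    · rw [ENNReal.tsum_sigma', ← ENNReal.tsum_mul_left]
      refine ENNReal.tsum_le_tsum fun n => ?_
      rw [tsum_fintype]
      simp only [Finset.sum_const, Finset.card_univ, Fintype.card_coe, nsmul_eq_mul]
      rw [← ENNReal.ofReal_natCast, ← ENNReal.ofReal_natCast, ← ENNReal.ofReal_mul (by positivity),
        ← ENNReal.ofReal_mul (by positivity)]
      apply ENNReal.ofReal_le_ofReal
      calc ((S (n + M)).card : ℝ) * Real.exp (-(s * ((n + M : ℕ) : ℝ)))
          ≤ K * Real.exp ((n + M : ℕ) * c) * Real.exp (-(s * ((n + M : ℕ) : ℝ))) := by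
            gcongr; exact hS1 _
        _ = _ := by
          rw [mul_assoc, ← Real.exp_add]; congr 2; ring
  refine le_antisymm (_root_.le_of_forall_pos_le_add fun η hη => ?_) bot_le
  obtain ⟨M, h1, h2⟩ := exists_small_tail (sub_pos.2 hcs) N
    (η := η / (K + 1)) (ENNReal.div_pos hη.ne' (by simp)).ne'
  refine (key M h1).trans ?_
  rw [zero_add]
  calc (K : ℝ≥0∞) * _ ≤ (K + 1) * (η / (K + 1)) := by gcongr; exact le_self_add
    _ ≤ η := ENNReal.mul_div_le

end PartB

section PartC

variable {X : Type*} [MetricSpace X] [MeasurableSpace X] [BorelSpace X]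

/-- The empirical measure of the points `T x, …, T^{n+1} x`. -/
noncomputable def emp (T : X → X) (n : ℕ) (x : X) : ProbabilityMeasure X :=
  ⟨(PMF.uniformOfFintype (Fin (n + 1))).toMeasure.map (fun i : Fin (n + 1) => T^[(i : ℕ) + 1] x),
    Measure.isProbabilityMeasure_map (measurable_of_finite _).aemeasurable⟩

lemma integral_emp (T : X → X) (n : ℕ) (x : X) {f : X → ℝ} (hf : Measurable f) :
    ∫ y, f y ∂(emp T n x : Measure X)
      = (∑ i ∈ Finset.range (n + 1), f (T^[i + 1] x)) / (n + 1) := by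
  simp only [emp, ProbabilityMeasure.coe_mk]
  rw [integral_map (measurable_of_finite _).aemeasurable hf.aestronglyMeasurable, PMF.integral_eq_sum,
    Finset.sum_range, Finset.sum_div]
  refine Finset.sum_congr rfl fun i _ => ?_
  have e : ((n : ℝ≥0∞) + 1).toReal = n + 1 := by exact_mod_cast ENNReal.toReal_natCast (n + 1)
  simp [div_eq_inv_mul, e]

lemma integral_pi_emp [SecondCountableTopology X] (T : X → X) (n : ℕ) (x : X) {r : ℕ}
    {Φ : (Fin r → X) → ℝ} (hΦ : Continuous Φ) :
    ∫ y, Φ y ∂(Measure.pi fun _ : Fin r => (emp T n x : Measure X)) = Vstat T Φ (n + 1) x := by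
  simp only [emp, ProbabilityMeasure.coe_mk]
  rw [← Measure.pi_map_pi (fun _ => (measurable_of_finite _).aemeasurable),
    integral_map (measurable_of_finite _).aemeasurable
      hΦ.measurable.aestronglyMeasurable, integral_fintype Integrable.of_finite, Vstat, Finset.sum_div]
  refine Finset.sum_congr rfl fun i _ => ?_
  rw [Measure.real, Measure.pi_singleton]
  have e : ((n : ℝ≥0∞) + 1).toReal = n + 1 := by exact_mod_cast ENNReal.toReal_natCast (n + 1)
  simp [div_eq_inv_mul, e]

lemma null_frontier_biInter {Y ι : Type*} [TopologicalSpace Y] [MeasurableSpace Y] (μ : Measure Y)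
    (F : Finset ι) (s : ι → Set Y)
    (h : ∀ i ∈ F, μ (frontier (s i)) = 0) : μ (frontier (⋂ i ∈ F, s i)) = 0 := by
  classical
  induction F using Finset.induction_on with
  | empty => simp
  | insert a F ha ih =>
    rw [Finset.set_biInter_insert]
    exact null_frontier_inter (h a (by simp)) (ih fun i hi => h i (by simp [hi]))

lemma exists_partition [CompactSpace X] (μ : Measure X) [IsProbabilityMeasure μ] {ε : ℝ} (hε : 0 < ε) :
    ∃ (k : ℕ) (P : X → Fin k), Measurable P ∧ (∀ x y, P x = P y → dist x y < ε) ∧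
      ∀ i, μ (frontier (P ⁻¹' {i})) = 0 := by
  have h : ∀ x : X, ∃ r ∈ Set.Ioo 0 (ε / 2), μ (frontier (Metric.ball x r)) = 0 := by
    intro x
    obtain ⟨r, hr, h⟩ := exists_null_frontier_thickening μ {x} (half_pos hε)
    rw [Metric.thickening_singleton] at h
    exact ⟨r, hr, h⟩
  choose r hr hr0 using h
  obtain ⟨t, ht⟩ := isCompact_univ.elim_finite_subcover (fun x : X => Metric.ball x (r x))
    (fun x => Metric.isOpen_ball) (fun x _ => Set.mem_iUnion.2 ⟨x, Metric.mem_ball_self (hr x).1⟩)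
  classical
  let Q : X → (t → Bool) := fun x i => decide (x ∈ Metric.ball (i : X) (r i))
  have hpre : ∀ w : t → Bool, Q ⁻¹' {w} = ⋂ i ∈ (Finset.univ : Finset t),
      (if w i then Metric.ball (i : X) (r i) else (Metric.ball (i : X) (r i))ᶜ) := by
    intro w
    ext x
    simp only [Q, Set.mem_preimage, Set.mem_singleton_iff, funext_iff, Set.mem_iInter,
      Finset.mem_univ, true_imp_iff]
    refine forall_congr' fun i => ?_
    cases w i <;> simp
  have hpre' : ∀ (e : (t → Bool) ≃ Fin (Fintype.card (t → Bool))) i,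
      (fun x => e (Q x)) ⁻¹' {i} = Q ⁻¹' {e.symm i} := by
    intro e i
    ext x
    simp [Equiv.eq_symm_apply]
  let e := Fintype.equivFin (t → Bool)
  refine ⟨_, fun x => e (Q x), ?_, ?_, ?_⟩
  · refine measurable_to_countable' fun i => ?_
    rw [hpre', hpre]
    refine Finset.measurableSet_biInter _ fun i _ => ?_
    split_ifs
    · exact measurableSet_ball
    · exact measurableSet_ball.compl
  · intro x y hxy
    have hQ : Q x = Q y := e.injective hxy
    obtain ⟨z, hz, hxz⟩ := Set.mem_iUnion₂.1 (ht (Set.mem_univ x))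
    have h1 := congrFun hQ ⟨z, hz⟩
    have hyz : y ∈ Metric.ball z (r z) := by
      simpa [Q, Metric.mem_ball.1 hxz] using h1
    have a1 := Metric.mem_ball.1 hxz
    have a2 := Metric.mem_ball'.1 hyz
    have := dist_triangle x z y
    have := (hr z).2
    linarith
  · intro i
    rw [hpre', hpre]
    refine null_frontier_biInter _ _ _ fun i _ => ?_
    split_ifs
    · exact hr0 _
    · rw [frontier_compl]; exact hr0 _

lemma key_nhds [CompactSpace X] [Nonempty X] (T : X → X) (hT : Continuous T) (μ : ProbabilityMeasure X)
    (hμ : MeasurePreserving T (μ : Measure X) μ) {s : ℝ≥0} (hs : hKS T (μ : Measure X) < s)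
    {ε : ℝ} (hε : 0 < ε) :
    ∃ U ∈ 𝓝 μ, ∀ N, bowenHn T {x | ∃ᶠ n : ℕ in atTop, emp T n x ∈ U} s ε N = 0 := by
  obtain ⟨k, P, hPm, hPd, hPf⟩ := exists_partition (μ : Measure X) hε
  have hs0 : (0 : ℝ) < s := by
    have : (0 : ℝ≥0∞) < s := lt_of_le_of_lt bot_le hs
    exact_mod_cast this
  have h1 : (⨅ n : ℕ, partEntropy (μ : Measure X)
      (fun x => fun j : Fin (n + 1) => P (T^[(j : ℕ)] x)) / (n + 1)) < s := by
    have : ENNReal.ofReal (⨅ n : ℕ, partEntropy (μ : Measure X)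
      (fun x => fun j : Fin (n + 1) => P (T^[(j : ℕ)] x)) / (n + 1)) < ENNReal.ofReal s := by
      refine lt_of_le_of_lt ?_ (by simpa using hs)
      exact le_iSup_of_le k (le_iSup_of_le P (le_iSup_of_le hPm le_rfl))
    exact (ENNReal.ofReal_lt_ofReal_iff hs0).1 this
  obtain ⟨n0, hn0⟩ := exists_lt_of_ciInf_lt h1
  obtain ⟨c, hc1, hcs⟩ := exists_between hn0
  set m := n0 + 1 with hm
  have hm0 : 0 < m := Nat.succ_pos _
  let R : X → (Fin m → Fin k) := fun x j => P (T^[(j : ℕ)] x)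
  have hRm : Measurable R := measurable_pi_lambda _ fun j => hPm.comp (hT.iterate j).measurable
  let p : (Fin m → Fin k) → ℝ := fun w => (μ : Measure X).real (R ⁻¹' {w})
  have hH : ∑ w, Real.negMulLog (p w) < m * c := by
    have : partEntropy (μ : Measure X) R / (m : ℝ) < c := by
      simpa [m] using hc1
    rw [div_lt_iff₀ (by positivity)] at this
    rw [mul_comm]; exact this
  have hp0 : ∀ w, 0 ≤ p w := fun w => measureReal_nonneg
  have hp1 : ∑ w, p w = 1 := by
    have := sum_measureReal_preimage_singleton (μ := (μ : Measure X)) (f := R) Finset.univ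
      (fun w _ => hRm (measurableSet_singleton w))
    simpa [p] using this
  set A : ℝ := (Fintype.card (Fin m → Fin k) : ℝ) with hA
  have hA0 : 0 ≤ A := by positivity
  obtain ⟨δ, hδ0, hδ⟩ : ∃ δ : ℝ, 0 < δ ∧ δ * A < m * c - ∑ w, Real.negMulLog (p w) := by
    refine ⟨(m * c - ∑ w, Real.negMulLog (p w)) / (A + 1), div_pos (by linarith) (by linarith), ?_⟩
    rw [div_mul_eq_mul_div, div_lt_iff₀ (by linarith)]
    nlinarith
  let q : (Fin m → Fin k) → ℝ := fun w => (p w + δ) / (1 + δ * A)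
  have hden : 0 < 1 + δ * A := by positivity
  have hq : ∀ w, 0 < q w := fun w => div_pos (by linarith [hp0 w]) hden
  have hq1 : ∑ w, q w = 1 := by
    simp only [q]
    rw [← Finset.sum_div, Finset.sum_add_distrib, hp1, div_eq_one_iff_eq hden.ne']
    simp [A, mul_comm]
  have hlt : ∑ w, p w * -Real.log (q w) < m * c := by
    have : ∀ w, p w * -Real.log (q w) ≤ Real.negMulLog (p w) + p w * (δ * A) := by
      intro w
      rcases (hp0 w).eq_or_lt with h | h
      · simp [← h]
      · have e1 : Real.log (q w) = Real.log (p w + δ) - Real.log (1 + δ * A) :=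
          Real.log_div (by linarith) hden.ne'
        have e2 : Real.log (p w) ≤ Real.log (p w + δ) := Real.log_le_log h (by linarith)
        have e3 : Real.log (1 + δ * A) ≤ δ * A := by
          have := Real.log_le_sub_one_of_pos hden; linarith
        rw [Real.negMulLog, e1]
        nlinarith
    have h2 := Finset.sum_le_sum fun w (_ : w ∈ Finset.univ) => this w
    rw [Finset.sum_add_distrib, ← Finset.sum_mul, hp1] at h2
    linarith
  have hfr : ∀ w, (μ : Measure X) (frontier (R ⁻¹' {w})) = 0 := by
    intro w
    have : R ⁻¹' {w} = ⋂ j ∈ (Finset.univ : Finset (Fin m)), T^[(j : ℕ)] ⁻¹' (P ⁻¹' {w j}) := by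
      ext x; simp [R, funext_iff]
    rw [this]
    refine null_frontier_biInter _ _ _ fun j _ => ?_
    refine measure_mono_null ((hT.iterate j).frontier_preimage_subset _) ?_
    rw [(hμ.iterate j).measure_preimage isClosed_frontier.measurableSet.nullMeasurableSet]
    exact hPf _
  have hcont : Tendsto (fun ν : ProbabilityMeasure X =>
      ∑ w, (ν : Measure X).real (R ⁻¹' {w}) * -Real.log (q w)) (𝓝 μ)
      (𝓝 (∑ w, p w * -Real.log (q w))) := by
    refine tendsto_finsetSum _ fun w _ => Tendsto.mul_const _ ?_
    have := ProbabilityMeasure.tendsto_measure_of_null_frontier_of_tendsto' (tendsto_id (α := ProbabilityMeasure X) (x := 𝓝 μ)) (hfr w)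
    exact (ENNReal.tendsto_toReal (measure_ne_top _ _)).comp this
  refine ⟨_, hcont.eventually (gt_mem_nhds hlt), fun N => ?_⟩
  refine le_antisymm ?_ bot_le
  rw [← bowenHn_zero_of_words T hm0 P hPd q hq hq1 hcs hs0 N]
  refine bowenHn_mono_set T ?_ _ _ _
  intro x hx
  refine (tendsto_add_atTop_nat 1).frequently (hx.mono fun n hn => ?_)
  have hn' : ∑ w, (emp T n x : Measure X).real (R ⁻¹' {w}) * -Real.log (q w) < m * c := hn
  have hint : ∑ w, (emp T n x : Measure X).real (R ⁻¹' {w}) * -Real.log (q w)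
      = ∫ y, -Real.log (q (R y)) ∂(emp T n x : Measure X) := by
    rw [← integral_map (φ := R) (f := fun w => -Real.log (q w)) hRm.aemeasurable
      (measurable_of_finite _).aestronglyMeasurable]
    have : IsProbabilityMeasure (Measure.map R (emp T n x : Measure X)) :=
      Measure.isProbabilityMeasure_map hRm.aemeasurable
    rw [integral_fintype Integrable.of_finite]
    refine Finset.sum_congr rfl fun w _ => ?_
    rw [map_measureReal_apply hRm (measurableSet_singleton w), smul_eq_mul]
  rw [hint, integral_emp T n x (f := fun y => -Real.log (q (R y)))
    ((measurable_of_finite (fun w => -Real.log (q w))).comp hRm), div_lt_iff₀ (by positivity)] at hn'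
  have := hn'.le
  push_cast
  rw [mul_comm]
  exact this

end PartC

section PartD

variable {X : Type*} [MetricSpace X] [CompactSpace X] [MeasurableSpace X] [BorelSpace X]

lemma continuous_integral_pi {r : ℕ} {Φ : (Fin r → X) → ℝ} (hΦ : Continuous Φ) :
    Continuous fun μ : ProbabilityMeasure X => ∫ y, Φ y ∂(Measure.pi fun _ : Fin r => (μ : Measure X)) := by
  have h1 : Continuous fun μ : ProbabilityMeasure X => ProbabilityMeasure.pi (fun _ : Fin r => μ) :=
    ProbabilityMeasure.continuous_pi.comp (_root_.continuous_pi fun _ => continuous_id)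
  have h2 := ProbabilityMeasure.continuous_integral_boundedContinuousFunction (X := Fin r → X)
    (BoundedContinuousFunction.mkOfCompact ⟨Φ, hΦ⟩)
  exact h2.comp h1

lemma measurePreserving_iff (T : X → X) (hT : Continuous T) (μ : ProbabilityMeasure X) :
    MeasurePreserving T (μ : Measure X) μ ↔
      ∀ f : C(X, ℝ), ∫ y, f (T y) ∂(μ : Measure X) = ∫ y, f y ∂(μ : Measure X) := by
  constructor
  · intro h f
    conv_rhs => rw [← h.map_eq]
    rw [integral_map hT.measurable.aemeasurable f.continuous.measurable.aestronglyMeasurable]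
  · intro h
    refine ⟨hT.measurable, ?_⟩
    have : IsProbabilityMeasure (Measure.map T (μ : Measure X)) :=
      Measure.isProbabilityMeasure_map hT.measurable.aemeasurable
    refine ext_of_forall_integral_eq_of_IsFiniteMeasure fun f => ?_
    rw [integral_map hT.measurable.aemeasurable f.continuous.measurable.aestronglyMeasurable]
    exact h f.toContinuousMap

lemma continuous_integral_cm (f : C(X, ℝ)) :
    Continuous fun μ : ProbabilityMeasure X => ∫ y, f y ∂(μ : Measure X) :=
  ProbabilityMeasure.continuous_integral_boundedContinuousFunction
    (BoundedContinuousFunction.mkOfCompact f)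

/-- The fiber `M_Φ(α)` inside the space of probability measures. -/
def Mfib {r : ℕ} (T : X → X) (Φ : (Fin r → X) → ℝ) (α : ℝ) : Set (ProbabilityMeasure X) :=
  {μ | (∀ f : C(X, ℝ), ∫ y, f (T y) ∂(μ : Measure X) = ∫ y, f y ∂(μ : Measure X)) ∧
    ∫ y, Φ y ∂(Measure.pi fun _ : Fin r => (μ : Measure X)) = α}

lemma isClosed_Mfib {r : ℕ} (T : X → X) (hT : Continuous T) {Φ : (Fin r → X) → ℝ}
    (hΦ : Continuous Φ) (α : ℝ) : IsClosed (Mfib T Φ α) := by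
  have : Mfib T Φ α = (⋂ f : C(X, ℝ), {μ : ProbabilityMeasure X |
      ∫ y, f (T y) ∂(μ : Measure X) = ∫ y, f y ∂(μ : Measure X)}) ∩
      {μ : ProbabilityMeasure X | ∫ y, Φ y ∂(Measure.pi fun _ : Fin r => (μ : Measure X)) = α} := by
    ext μ; simp [Mfib]
  rw [this]
  refine (isClosed_iInter fun f => ?_).inter ?_
  · exact isClosed_eq (continuous_integral_cm (f.comp ⟨T, hT⟩)) (continuous_integral_cm f)
  · exact isClosed_eq (continuous_integral_pi hΦ) continuous_const

lemma tendsto_const_div_nat (a : ℝ) : Tendsto (fun n : ℕ => a / ((n : ℝ) + 1)) atTop (𝓝 0) := by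
  have := (tendsto_one_div_add_atTop_nhds_zero_nat (𝕜 := ℝ)).const_mul a
  simpa [div_eq_mul_inv] using this

lemma emp_invariance (T : X → X) (hT : Continuous T) (x : X) (f : C(X, ℝ)) :
    Tendsto (fun n => ∫ y, f (T y) ∂(emp T n x : Measure X) - ∫ y, f y ∂(emp T n x : Measure X))
      atTop (𝓝 0) := by
  refine squeeze_zero_norm (a := fun n : ℕ => (2 * ‖f‖) / ((n : ℝ) + 1)) (fun n => ?_)
    (tendsto_const_div_nat _)
  rw [integral_emp T n x (f := fun y => f (T y)) (f.continuous.comp hT).measurable,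
    integral_emp T n x f.continuous.measurable, ← sub_div, ← Finset.sum_sub_distrib]
  have : ∀ i, f (T (T^[i + 1] x)) - f (T^[i + 1] x)
      = (fun i => f (T^[i + 1] x)) (i + 1) - (fun i => f (T^[i + 1] x)) i := by
    intro i
    simp only [Function.iterate_succ_apply' T (i + 1)]
  rw [Finset.sum_congr rfl fun i _ => this i, Finset.sum_range_sub (fun i => f (T^[i + 1] x)), norm_div]
  have hn : ‖(n : ℝ) + 1‖ = n + 1 := by
    rw [Real.norm_eq_abs, abs_of_pos (by positivity)]
  rw [hn]
  gcongr
  calc _ ≤ ‖f (T^[n + 1 + 1] x)‖ + ‖f (T^[0 + 1] x)‖ := norm_sub_le _ _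
    _ ≤ ‖f‖ + ‖f‖ := add_le_add (f.norm_coe_le_norm _) (f.norm_coe_le_norm _)
    _ = _ := by ring

lemma exists_cluster {r : ℕ} (T : X → X) (hT : Continuous T) {Φ : (Fin r → X) → ℝ}
    (hΦ : Continuous Φ) (α : ℝ) {x : X} (hx : x ∈ Eset T Φ α) :
    ∃ μ ∈ Mfib T Φ α, MapClusterPt μ atTop (fun n => emp T n x) := by
  obtain ⟨μ, hμ⟩ := exists_clusterPt_of_compactSpace (map (fun n => emp T n x) atTop)
  have hμ' : MapClusterPt μ atTop (fun n => emp T n x) := hμ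
  refine ⟨μ, ?_, hμ'⟩
  obtain ⟨F, hF, hlim⟩ := mapClusterPt_iff_ultrafilter.1 hμ'
  refine ⟨fun f => ?_, ?_⟩
  · have h1 := ((continuous_integral_cm (f.comp ⟨T, hT⟩)).tendsto μ).comp hlim
    have h2 := ((continuous_integral_cm f).tendsto μ).comp hlim
    have h3 := (emp_invariance T hT x f).mono_left hF
    exact sub_eq_zero.1 (tendsto_nhds_unique (h1.sub h2) h3)
  · have h1 := ((continuous_integral_pi hΦ).tendsto μ).comp hlim
    have h2 : Tendsto (fun n => Vstat T Φ (n + 1) x) atTop (𝓝 α) :=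
      (tendsto_add_atTop_iff_nat 1).2 hx
    have h3 := h2.mono_left hF
    refine tendsto_nhds_unique h1 (h3.congr fun n => ?_)
    exact (integral_pi_emp T n x hΦ).symm

lemma generic_tendsto_emp (T : X → X) (μ : ProbabilityMeasure X) {x : X}
    (hx : IsGenericPt T (μ : Measure X) x) : Tendsto (fun n => emp T n x) atTop (𝓝 μ) := by
  rw [ProbabilityMeasure.tendsto_iff_forall_integral_tendsto]
  intro f
  have h1 := (tendsto_add_atTop_iff_nat 2).2 (hx f.toContinuousMap)
  have h2 : Tendsto (fun n : ℕ => 1 + 1 / ((n : ℝ) + 1)) atTop (𝓝 (1 + 0)) :=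
    tendsto_const_nhds.add (tendsto_const_div_nat 1)
  have h3 := (h1.mul h2).sub (tendsto_const_div_nat (f x))
  simp only [add_zero, mul_one, sub_zero] at h3
  refine h3.congr fun n => ?_
  rw [integral_emp T n x f.continuous.measurable, Finset.sum_range_succ']
  have e1 : ((n : ℝ) + 1) ≠ 0 := by positivity
  have e2 : ((n : ℝ) + 2) ≠ 0 := by positivity
  simp only [BoundedContinuousFunction.coe_toContinuousMap, Function.iterate_zero, id]
  push_cast
  field_simp
  ring

lemma generic_subset_Eset {r : ℕ} (T : X → X) {Φ : (Fin r → X) → ℝ}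
    (hΦ : Continuous Φ) (α : ℝ) {μ : Measure X} (hμ : μ ∈ Mset T Φ α) :
    {x | IsGenericPt T μ x} ⊆ Eset T Φ α := by
  intro x hx
  obtain ⟨hp, hinv, hα⟩ := hμ
  have h1 := generic_tendsto_emp T ⟨μ, hp⟩ (x := x) hx
  have h2 := ((continuous_integral_pi hΦ).tendsto _).comp h1
  refine (tendsto_add_atTop_iff_nat 1).1 ?_
  have h3 : Tendsto (fun n => ∫ y, Φ y ∂(Measure.pi fun _ : Fin r => (emp T n x : Measure X)))
      atTop (𝓝 α) := by
    rw [← hα]; exact h2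
  exact h3.congr fun n => integral_pi_emp T n x hΦ

lemma Eset_null [Nonempty X] {r : ℕ} (T : X → X) (hT : Continuous T) {Φ : (Fin r → X) → ℝ}
    (hΦ : Continuous Φ) (α : ℝ) {s : ℝ≥0} (hs : ∀ μ ∈ Mset T Φ α, hKS T μ < s) (hs0 : 0 < s)
    {ε : ℝ} (hε : 0 < ε) (N : ℕ) : bowenHn T (Eset T Φ α) s ε N = 0 := by
  have hs0' : (0 : ℝ) < s := by exact_mod_cast hs0
  have hcomp : IsCompact (Mfib T Φ α) := (isClosed_Mfib T hT hΦ α).isCompact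
  have hO : ∃ O : Set (ProbabilityMeasure X), IsOpen O ∧ Mfib T Φ α ⊆ O ∧
      bowenHn T {x | ∃ᶠ n : ℕ in atTop, emp T n x ∈ O} s ε N = 0 := by
    refine hcomp.induction_on (p := fun K => ∃ O : Set (ProbabilityMeasure X), IsOpen O ∧ K ⊆ O ∧
      bowenHn T {x | ∃ᶠ n : ℕ in atTop, emp T n x ∈ O} s ε N = 0) ?_ ?_ ?_ ?_
    · refine ⟨∅, isOpen_empty, le_rfl, le_antisymm ?_ bot_le⟩
      refine (bowenHn_le_tsum T _ hs0' ε N (ι := Empty) (fun i => i.elim) ?_ (fun i => i.elim)).trans ?_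
      · intro x hx; simp at hx
      · simp
    · rintro K K' h ⟨O, h1, h2, h3⟩
      exact ⟨O, h1, h.trans h2, h3⟩
    · rintro K K' ⟨O, h1, h2, h3⟩ ⟨O', h1', h2', h3'⟩
      refine ⟨O ∪ O', h1.union h1', Set.union_subset_union h2 h2', ?_⟩
      rw [← bowenHn_union_zero T hs0' ε N h3 h3']
      congr 1
      ext x
      simp [frequently_or_distrib]
    · intro μ hμ
      have hinv := (measurePreserving_iff T hT μ).2 hμ.1
      obtain ⟨U, hU, h⟩ := key_nhds T hT μ hinv (hs μ ⟨inferInstance, hinv, hμ.2⟩) hε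
      obtain ⟨O, hOU, hO, hμO⟩ := mem_nhds_iff.1 hU
      refine ⟨O, mem_nhdsWithin_of_mem_nhds (hO.mem_nhds hμO), O, hO, le_rfl, le_antisymm ?_ bot_le⟩
      rw [← h N]
      exact bowenHn_mono_set T (fun x hx => hx.mono fun n hn => hOU hn) _ _ _
  obtain ⟨O, hO, hMO, h0⟩ := hO
  refine le_antisymm ?_ bot_le
  rw [← h0]
  refine bowenHn_mono_set T (fun x hx => ?_) _ _ _
  obtain ⟨μ, hμ, hcl⟩ := exists_cluster T hT hΦ α hx
  exact hcl.frequently (hO.mem_nhds (hMO hμ))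

end PartD

/-- (Theorem 1.1) For a saturated system, if `M_Φ(α) ≠ ∅` then
`h_top(E_Φ(α)) = sup_{μ ∈ M_Φ(α)} h_μ`. -/
theorem htop_Eset_eq_iSup_hKS_of_saturated
    {X : Type*} [MetricSpace X] [CompactSpace X] [MeasurableSpace X] [BorelSpace X]
    (T : X → X) (hT : Continuous T) (hsat : Saturated T) (r : ℕ) (hr : 1 ≤ r)
    (Φ : (Fin r → X) → ℝ) (hΦ : Continuous Φ) (α : ℝ)
    (hM : (Mset T Φ α).Nonempty) :
    htop T (Eset T Φ α) = ⨆ μ ∈ Mset T Φ α, hKS T μ := by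
  apply le_antisymm
  · have hne : Nonempty X := by
      obtain ⟨μ, hp, -⟩ := hM
      exact nonempty_of_isProbabilityMeasure μ
    refine le_of_forall_gt fun t ht => ?_
    obtain ⟨s, hs1, hs2⟩ := ENNReal.lt_iff_exists_nnreal_btwn.1 ht
    refine lt_of_le_of_lt ?_ hs2
    refine iSup_le fun ε => iSup_le fun hε => ?_
    refine iInf_le_of_le s (iInf_le_of_le ?_ le_rfl)
    have hs0 : 0 < s := by
      have : (0 : ℝ≥0∞) < s := lt_of_le_of_lt bot_le hs1
      exact_mod_cast this
    have hs : ∀ μ ∈ Mset T Φ α, hKS T μ < s := fun μ hμ =>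
      lt_of_le_of_lt (le_iSup₂ (f := fun μ (_ : μ ∈ Mset T Φ α) => hKS T μ) μ hμ) hs1
    exact le_antisymm (iSup_le fun N => (Eset_null T hT hΦ α hs hs0 hε N).le) bot_le
  · refine iSup₂_le fun μ hμ => ?_
    rw [← hsat μ hμ.1 hμ.2.1]
    exact htop_mono T (generic_subset_Eset T hΦ α hμ)
end
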